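/- Let R = ∏_{i ∈ I} R_i be a direct product of rings R_i. Then R is CUSC (respectively, UUSC) if and only if each R_i is CUSC (respectively, UUSC). -/

import Mathlib

/-- An element `a` of a ring is *uniquely strongly clean* if there is exactly one
idempotent `e` such that `a - e` is a unit and `a * e = e * a`. -/
def IsUSCleanElem {R : Type*} [Ring R] (a : R) : Prop :=
  ∃! e : R, IsIdempotentElem e ∧ IsUnit (a - e) ∧ a * e = e * a

/-- An element `a` of a ring is *uniquely clean* if there is exactly one
idempotent `e` such that `a - e` is a unit. -/
def IsUCleanElem {R : Type*} [Ring R] (a : R) : Prop :=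
  ∃! e : R, IsIdempotentElem e ∧ IsUnit (a - e)

/-- An element `a` of a ring is *clean* if it is the sum of an idempotent and a unit. -/
def IsCleanElem {R : Type*} [Ring R] (a : R) : Prop :=
  ∃ e : R, IsIdempotentElem e ∧ IsUnit (a - e)

/-- A ring is *CUSC* if every clean element is uniquely strongly clean. -/
def IsCUSC (R : Type*) [Ring R] : Prop := ∀ a : R, IsCleanElem a → IsUSCleanElem a

/-- A ring is *UUSC* if every unit is uniquely strongly clean. -/
def IsUUSC (R : Type*) [Ring R] : Prop := ∀ a : R, IsUnit a → IsUSCleanElem a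

/-- A ring is *CUC* if every clean element is uniquely clean. -/
def IsCUC (R : Type*) [Ring R] : Prop := ∀ a : R, IsCleanElem a → IsUCleanElem a

/-- A ring is *UUC* if every unit is uniquely clean. -/
def IsUUC (R : Type*) [Ring R] : Prop := ∀ a : R, IsUnit a → IsUCleanElem a

/-- A ring is *USC* if every element is uniquely strongly clean. -/
def IsUSCRing (R : Type*) [Ring R] : Prop := ∀ a : R, IsUSCleanElem a

/-- A ring is *uniquely clean* (UC) if every element is uniquely clean. -/
def IsUCRing (R : Type*) [Ring R] : Prop := ∀ a : R, IsUCleanElem a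

/-- A ring is *clean* if every element is clean. -/
def IsCleanRing (R : Type*) [Ring R] : Prop := ∀ a : R, IsCleanElem a

/-- The Jacobson radical of a (possibly noncommutative) ring, as a two-sided ideal. -/
abbrev jacobsonRad (R : Type*) [Ring R] : TwoSidedIdeal R := TwoSidedIdeal.jacobson ⊥

/-- The quotient ring `R / J(R)` of a ring by its Jacobson radical. -/
abbrev JacQuot (R : Type*) [Ring R] := (jacobsonRad R).ringCon.Quotient

/-- A ring is *semi-potent* if every one-sided (left or right) ideal not contained in the
Jacobson radical contains a nonzero idempotent.  Left ideals are `Ideal R`, right ideals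
are `Rᵐᵒᵖ`-submodules of `R`. -/
def Semipotent (R : Type*) [Ring R] : Prop :=
  (∀ I : Ideal R, ¬ (I : Set R) ⊆ (jacobsonRad R : Set R) →
      ∃ e ∈ I, e ≠ 0 ∧ IsIdempotentElem e) ∧
  (∀ I : Submodule Rᵐᵒᵖ R, ¬ (I : Set R) ⊆ (jacobsonRad R : Set R) →
      ∃ e ∈ I, e ≠ 0 ∧ IsIdempotentElem e)

/-- Idempotents lift modulo the Jacobson radical: for every `a` with `a - a ^ 2 ∈ J(R)`
there is an idempotent `e` with `a - e ∈ J(R)`. -/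
def IdempotentsLiftJac (R : Type*) [Ring R] : Prop :=
  ∀ a : R, a - a ^ 2 ∈ jacobsonRad R → ∃ e : R, IsIdempotentElem e ∧ a - e ∈ jacobsonRad R

/-- A ring is *potent* if it is semi-potent and idempotents lift modulo the Jacobson radical. -/
def Potent (R : Type*) [Ring R] : Prop := Semipotent R ∧ IdempotentsLiftJac R

theorem existsUnique_pi_iff {ι : Type*} {α : ι → Type*} {p : ∀ i, α i → Prop} :
    (∃! f : ∀ i, α i, ∀ i, p i (f i)) ↔ ∀ i, ∃! x, p i x := by
  classical
  constructor
  · rintro ⟨f, hf, huniq⟩ i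
    refine ⟨f i, hf i, fun x hx => ?_⟩
    have h : Function.update f i x = f := huniq _ fun j => by
      obtain rfl | hj := eq_or_ne j i
      · simpa using hx
      · simpa [hj] using hf j
    simpa using congrFun h i
  · intro h
    choose f hf huniq using h
    exact ⟨f, hf, fun g hg => funext fun i => huniq i _ (hg i)⟩

theorem Pi.isUSCleanElem_iff {ι : Type*} {R : ι → Type*} [∀ i, Ring (R i)] {a : ∀ i, R i} :
    IsUSCleanElem a ↔ ∀ i, IsUSCleanElem (a i) := by
  simp only [IsUSCleanElem, ← existsUnique_pi_iff, IsIdempotentElem, Pi.isUnit_iff,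
    funext_iff, Pi.mul_apply, Pi.sub_apply, forall_and]

theorem Pi.isCleanElem_iff {ι : Type*} {R : ι → Type*} [∀ i, Ring (R i)] {a : ∀ i, R i} :
    IsCleanElem a ↔ ∀ i, IsCleanElem (a i) := by
  simp only [IsCleanElem, Classical.skolem, IsIdempotentElem, Pi.isUnit_iff,
    funext_iff, Pi.mul_apply, Pi.sub_apply, forall_and]

theorem IsUnit.isCleanElem {R : Type*} [Ring R] {a : R} (ha : IsUnit a) : IsCleanElem a :=
  ⟨0, IsIdempotentElem.zero, by simpa using ha⟩

/-- A property of elements that holds at `1` and is tested componentwise implies unique strong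
cleanness on the product if and only if it does so on each factor. -/
theorem Pi.forall_imp_isUSCleanElem_iff {ι : Type*} {R : ι → Type*} [∀ i, Ring (R i)]
    {p : ∀ i, R i → Prop} (h_one : ∀ i, p i 1) :
    (∀ a : ∀ i, R i, (∀ i, p i (a i)) → IsUSCleanElem a) ↔
      ∀ i, ∀ x : R i, p i x → IsUSCleanElem x := by
  classical
  refine ⟨fun h i x hx => ?_, fun h a ha => Pi.isUSCleanElem_iff.2 fun i => h i _ (ha i)⟩
  have hu : IsUSCleanElem (Function.update (1 : ∀ i, R i) i x) := h _ fun j => by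
    obtain rfl | hj := eq_or_ne j i
    · simpa using hx
    · simpa [hj] using h_one j
  simpa using Pi.isUSCleanElem_iff.1 hu i

/-- Proposition 2.5: a direct product of rings is CUSC (resp. UUSC) iff
every factor is CUSC (resp. UUSC). -/
theorem stmt_2 {I : Type*} (R : I → Type*) [∀ i, Ring (R i)] :
    (IsCUSC (∀ i, R i) ↔ ∀ i, IsCUSC (R i)) ∧
    (IsUUSC (∀ i, R i) ↔ ∀ i, IsUUSC (R i)) := by
  simp only [IsCUSC, IsUUSC, Pi.isCleanElem_iff, Pi.isUnit_iff]
  exact ⟨Pi.forall_imp_isUSCleanElem_iff fun _ => isUnit_one.isCleanElem,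
    Pi.forall_imp_isUSCleanElem_iff fun _ => isUnit_one⟩
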